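/- arXiv:1808.04320 — 4 statements merged into one kernel-verified Lean document; each statement's English description precedes it below -/
import Mathlib

section
/- Let w be a real number and Φ(X,P) a smooth function on (ℝ^{n+2} ∖ {0}) × ℝ^{n+2} satisfying X·∂_P Φ = 0 and X·∂_X Φ = w Φ. Then η^{AB} ∂_{P^A}(D_B Φ) = (2w + n) η^{AB} ∂_{P^A} ∂_{X^B} Φ, where D_B = 2(X·∂_X + n/2)∂_{X^B} − X_B □_X acts in the X variable. -/
noncomputable section

/-- Partial derivative in the `X` variable, direction `A`, of a function `Φ(X,P)`. -/
def pdX {m : ℕ} (A : Fin m) (Φ : (Fin m → ℝ) → (Fin m → ℝ) → ℝ) :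
    (Fin m → ℝ) → (Fin m → ℝ) → ℝ :=
  fun x p => fderiv ℝ (fun y => Φ y p) x (Pi.single A 1)

/-- Partial derivative in the `P` variable, direction `A`, of a function `Φ(X,P)`. -/
def pdP {m : ℕ} (A : Fin m) (Φ : (Fin m → ℝ) → (Fin m → ℝ) → ℝ) :
    (Fin m → ℝ) → (Fin m → ℝ) → ℝ :=
  fun x p => fderiv ℝ (Φ x) p (Pi.single A 1)

/-- The Euler operator `X·∂_X`. -/
def eulerX {m : ℕ} (Φ : (Fin m → ℝ) → (Fin m → ℝ) → ℝ) :
    (Fin m → ℝ) → (Fin m → ℝ) → ℝ :=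
  fun x p => ∑ A, x A * pdX A Φ x p

/-- The ambient Laplacian `□_X = η^{AB} ∂_{X^A} ∂_{X^B}` for the diagonal metric `ε`. -/
def lapX {m : ℕ} (ε : Fin m → ℝ) (Φ : (Fin m → ℝ) → (Fin m → ℝ) → ℝ) :
    (Fin m → ℝ) → (Fin m → ℝ) → ℝ :=
  fun x p => ∑ A, ε A * pdX A (pdX A Φ) x p

/-- `ε` is a diagonal metric with all entries `±1` and exactly `q` entries equal to `-1`,
i.e. a nondegenerate symmetric bilinear form of signature `(m - q, q)`. -/
def isSig {m : ℕ} (ε : Fin m → ℝ) (q : ℕ) : Prop :=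
  (∀ A, ε A = 1 ∨ ε A = -1) ∧ Nat.card {A : Fin m // ε A = -1} = q

/-- The flat Thomas-D operator `D_A = 2(X·∂_X + c)∂_{X^A} - X_A □_X` acting in the `X`
variable (with `c = n/2`). -/
def thomasDX {m : ℕ} (ε : Fin m → ℝ) (c : ℝ) (A : Fin m)
    (Φ : (Fin m → ℝ) → (Fin m → ℝ) → ℝ) : (Fin m → ℝ) → (Fin m → ℝ) → ℝ :=
  fun x p => 2 * (eulerX (pdX A Φ) x p + c * pdX A Φ x p) - ε A * x A * lapX ε Φ x p

/-- The operator `P·D = P_A D^A` (`P` acting by multiplication). -/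
def opPD {m : ℕ} (ε : Fin m → ℝ) (c : ℝ) (Φ : (Fin m → ℝ) → (Fin m → ℝ) → ℝ) :
    (Fin m → ℝ) → (Fin m → ℝ) → ℝ :=
  fun x p => ∑ A, p A * thomasDX ε c A Φ x p

/-- The operator `I·D = I^A D_A` for a fixed ambient vector `I`. -/
def opID {m : ℕ} (ε : Fin m → ℝ) (c : ℝ) (I : Fin m → ℝ)
    (Φ : (Fin m → ℝ) → (Fin m → ℝ) → ℝ) : (Fin m → ℝ) → (Fin m → ℝ) → ℝ :=
  fun x p => ∑ A, I A * thomasDX ε c A Φ x p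

/-- The operator `I·∂_P = I^A ∂_{P^A}` for a fixed ambient vector `I`. -/
def opIdP {m : ℕ} (I : Fin m → ℝ) (Φ : (Fin m → ℝ) → (Fin m → ℝ) → ℝ) :
    (Fin m → ℝ) → (Fin m → ℝ) → ℝ :=
  fun x p => ∑ A, I A * pdP A Φ x p

/-- `Φ(X,P)` is jointly smooth at every point with `X ≠ 0`. -/
def SmoothOffZero {m : ℕ} (Φ : (Fin m → ℝ) → (Fin m → ℝ) → ℝ) : Prop :=
  ∀ x p : Fin m → ℝ, x ≠ 0 → ContDiffAt ℝ (⊤ : ℕ∞) (Function.uncurry Φ) (x, p)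

theorem eventually_fst_ne_zero {m : ℕ} {x : Fin m → ℝ} (hx : x ≠ 0) (p : Fin m → ℝ) :
    ∀ᶠ q : (Fin m → ℝ) × (Fin m → ℝ) in nhds (x, p), q.1 ≠ 0 :=
  continuous_fst.continuousAt.eventually_ne hx

/-- The directional derivative of a smooth function is smooth. -/
theorem ContDiffAt.fderiv_apply_const {E : Type*} [NormedAddCommGroup E] [NormedSpace ℝ E]
    {F : E → ℝ} {q : E} (hF : ContDiffAt ℝ (⊤ : ℕ∞) F q) (v : E) :
    ContDiffAt ℝ (⊤ : ℕ∞) (fun z => fderiv ℝ F z v) q :=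
  (hF.fderiv_right (m := (⊤ : ℕ∞)) le_rfl).clm_apply contDiffAt_const

/-- Directional derivatives of a smooth function commute. -/
theorem ContDiffAt.fderiv_fderiv_apply_comm {E : Type*} [NormedAddCommGroup E]
    [NormedSpace ℝ E] {F : E → ℝ} {q : E} (hF : ContDiffAt ℝ (⊤ : ℕ∞) F q) (u v : E) :
    fderiv ℝ (fun z => fderiv ℝ F z u) q v = fderiv ℝ (fun z => fderiv ℝ F z v) q u := by
  have hd : DifferentiableAt ℝ (fderiv ℝ F) q :=
    (hF.fderiv_right (m := (⊤ : ℕ∞)) le_rfl).differentiableAt (by simp)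
  have hs : IsSymmSndFDerivAt ℝ F q := hF.isSymmSndFDerivAt (by
    simp only [minSmoothness_of_isRCLikeNormedField]
    exact WithTop.coe_le_coe.2 (le_top : (2 : ℕ∞) ≤ ⊤))
  rw [fderiv_clm_apply hd (differentiableAt_const u), fderiv_clm_apply hd (differentiableAt_const v)]
  simpa using hs v u

namespace SmoothOffZero

variable {m : ℕ} {Φ Ψ : (Fin m → ℝ) → (Fin m → ℝ) → ℝ}

theorem differentiableAt (h : SmoothOffZero Φ) {x : Fin m → ℝ} (hx : x ≠ 0) (p : Fin m → ℝ) :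
    DifferentiableAt ℝ (Function.uncurry Φ) (x, p) :=
  (h x p hx).differentiableAt (by simp)

theorem differentiableAt_left (h : SmoothOffZero Φ) {x : Fin m → ℝ} (hx : x ≠ 0)
    (p : Fin m → ℝ) : DifferentiableAt ℝ (fun y => Φ y p) x :=
  DifferentiableAt.comp (g := Function.uncurry Φ) (f := fun y => (y, p)) x
    (h.differentiableAt hx p)
    (differentiableAt_id.prodMk (differentiableAt_const p))

theorem differentiableAt_right (h : SmoothOffZero Φ) {x : Fin m → ℝ} (hx : x ≠ 0)
    (p : Fin m → ℝ) : DifferentiableAt ℝ (Φ x) p :=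
  DifferentiableAt.comp (g := Function.uncurry Φ) (f := fun y => (x, y)) p
    (h.differentiableAt hx p)
    ((differentiableAt_const x).prodMk differentiableAt_id)

theorem pdX_eq_fderiv (h : SmoothOffZero Φ) (A : Fin m) {x : Fin m → ℝ} (hx : x ≠ 0)
    (p : Fin m → ℝ) :
    pdX A Φ x p = fderiv ℝ (Function.uncurry Φ) (x, p) (Pi.single A 1, 0) := by
  have := (HasFDerivAt.comp (f := fun y => (y, p)) x (h.differentiableAt hx p).hasFDerivAt
    ((hasFDerivAt_id x).prodMk (hasFDerivAt_const p x))).fderiv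
  have e : (Function.uncurry Φ ∘ fun y => (y, p)) = fun y => Φ y p := rfl
  rw [e] at this
  simp [pdX, this]

theorem pdP_eq_fderiv (h : SmoothOffZero Φ) (A : Fin m) {x : Fin m → ℝ} (hx : x ≠ 0)
    (p : Fin m → ℝ) :
    pdP A Φ x p = fderiv ℝ (Function.uncurry Φ) (x, p) (0, Pi.single A 1) := by
  have := (HasFDerivAt.comp (f := fun y => (x, y)) p (h.differentiableAt hx p).hasFDerivAt
    ((hasFDerivAt_const x p).prodMk (hasFDerivAt_id p))).fderiv
  have e : (Function.uncurry Φ ∘ fun y => (x, y)) = Φ x := rfl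
  rw [e] at this
  simp [pdP, this]

theorem uncurry_pdX_eventuallyEq (h : SmoothOffZero Φ) (A : Fin m) {x : Fin m → ℝ}
    (hx : x ≠ 0) (p : Fin m → ℝ) :
    Function.uncurry (pdX A Φ) =ᶠ[nhds (x, p)]
      fun z => fderiv ℝ (Function.uncurry Φ) z (Pi.single A 1, 0) := by
  filter_upwards [eventually_fst_ne_zero hx p] with q hq
  exact h.pdX_eq_fderiv A hq q.2

theorem uncurry_pdP_eventuallyEq (h : SmoothOffZero Φ) (A : Fin m) {x : Fin m → ℝ}
    (hx : x ≠ 0) (p : Fin m → ℝ) :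
    Function.uncurry (pdP A Φ) =ᶠ[nhds (x, p)]
      fun z => fderiv ℝ (Function.uncurry Φ) z (0, Pi.single A 1) := by
  filter_upwards [eventually_fst_ne_zero hx p] with q hq
  exact h.pdP_eq_fderiv A hq q.2

theorem partialX (h : SmoothOffZero Φ) (A : Fin m) : SmoothOffZero (pdX A Φ) := fun x p hx =>
  ((h x p hx).fderiv_apply_const _).congr_of_eventuallyEq (h.uncurry_pdX_eventuallyEq A hx p)

theorem partialP (h : SmoothOffZero Φ) (A : Fin m) : SmoothOffZero (pdP A Φ) := fun x p hx =>
  ((h x p hx).fderiv_apply_const _).congr_of_eventuallyEq (h.uncurry_pdP_eventuallyEq A hx p)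

theorem sum_coord_mul {Ψ : Fin m → (Fin m → ℝ) → (Fin m → ℝ) → ℝ}
    (h : ∀ B, SmoothOffZero (Ψ B)) : SmoothOffZero fun x p => ∑ B, x B * Ψ B x p :=
  fun x p hx => ContDiffAt.sum fun B _ =>
    (contDiff_apply ℝ ℝ B |>.comp contDiff_fst).contDiffAt.mul (h B x p hx)

theorem pdX_pdP_comm (h : SmoothOffZero Φ) (A B : Fin m) {x : Fin m → ℝ} (hx : x ≠ 0)
    (p : Fin m → ℝ) : pdX A (pdP B Φ) x p = pdP B (pdX A Φ) x p := by
  rw [(h.partialP B).pdX_eq_fderiv A hx, (h.partialX A).pdP_eq_fderiv B hx,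
    (h.uncurry_pdP_eventuallyEq B hx p).fderiv_eq, (h.uncurry_pdX_eventuallyEq A hx p).fderiv_eq]
  exact (h x p hx).fderiv_fderiv_apply_comm _ _

theorem pdX_pdX_comm (h : SmoothOffZero Φ) (A B : Fin m) {x : Fin m → ℝ} (hx : x ≠ 0)
    (p : Fin m → ℝ) : pdX A (pdX B Φ) x p = pdX B (pdX A Φ) x p := by
  rw [(h.partialX B).pdX_eq_fderiv A hx, (h.partialX A).pdX_eq_fderiv B hx,
    (h.uncurry_pdX_eventuallyEq B hx p).fderiv_eq, (h.uncurry_pdX_eventuallyEq A hx p).fderiv_eq]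
  exact (h x p hx).fderiv_fderiv_apply_comm _ _

theorem pdX_add (h : SmoothOffZero Φ) (h' : SmoothOffZero Ψ) (A : Fin m) {x : Fin m → ℝ}
    (hx : x ≠ 0) (p : Fin m → ℝ) :
    pdX A (fun y p => Φ y p + Ψ y p) x p = pdX A Φ x p + pdX A Ψ x p := by
  simp only [pdX]
  rw [fderiv_fun_add (h.differentiableAt_left hx p) (h'.differentiableAt_left hx p)]
  rfl

theorem pdX_const_mul (h : SmoothOffZero Φ) (c : ℝ) (A : Fin m) {x : Fin m → ℝ}
    (hx : x ≠ 0) (p : Fin m → ℝ) :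
    pdX A (fun y p => c * Φ y p) x p = c * pdX A Φ x p := by
  simp only [pdX]
  rw [fderiv_const_mul (h.differentiableAt_left hx p)]
  rfl

/-- The commutator `[∂_{X^A}, X^B] = δ_A^B`, contracted with a family of functions. -/
theorem pdX_sum_coord_mul {Ψ : Fin m → (Fin m → ℝ) → (Fin m → ℝ) → ℝ}
    (h : ∀ B, SmoothOffZero (Ψ B)) (A : Fin m) {x : Fin m → ℝ} (hx : x ≠ 0) (p : Fin m → ℝ) :
    pdX A (fun y p => ∑ B, y B * Ψ B y p) x p
      = Ψ A x p + ∑ B, x B * pdX A (Ψ B) x p := by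
  have hd : ∀ B, HasFDerivAt (fun y : Fin m → ℝ => y B * Ψ B y p)
      (x B • fderiv ℝ (fun y => Ψ B y p) x
        + Ψ B x p • (ContinuousLinearMap.proj B : (Fin m → ℝ) →L[ℝ] ℝ)) x := fun B =>
    (hasFDerivAt_apply B x).mul ((h B).differentiableAt_left hx p).hasFDerivAt
  simp only [pdX]
  rw [(HasFDerivAt.fun_sum fun B _ => hd B).fderiv]
  simp [Finset.sum_add_distrib, Pi.single_apply, add_comm]

end SmoothOffZero

theorem pdX_congr_of_ne_zero {m : ℕ} {Φ Ψ : (Fin m → ℝ) → (Fin m → ℝ) → ℝ}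
    (h : ∀ x p, x ≠ 0 → Φ x p = Ψ x p) (A : Fin m) {x : Fin m → ℝ} (hx : x ≠ 0)
    (p : Fin m → ℝ) : pdX A Φ x p = pdX A Ψ x p := by
  have : (fun y => Φ y p) =ᶠ[nhds x] fun y => Ψ y p := by
    filter_upwards [eventually_ne_nhds hx] with y hy using h y p hy
  simp only [pdX, this.fderiv_eq]

theorem pdX_zero {m : ℕ} (A : Fin m) (x p : Fin m → ℝ) : pdX A (fun _ _ => (0 : ℝ)) x p = 0 := by
  simp [pdX]

/-- If `Φ` is homogeneous of degree `w` in `X`, then `∂_{X^A} Φ` is homogeneous of degree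
`w - 1`. -/
theorem eulerX_pdX_of_homogeneous {m : ℕ} {Φ : (Fin m → ℝ) → (Fin m → ℝ) → ℝ}
    (hΦ : SmoothOffZero Φ) {w : ℝ} (h : ∀ x p, x ≠ 0 → eulerX Φ x p = w * Φ x p) (A : Fin m)
    {x : Fin m → ℝ} (hx : x ≠ 0) (p : Fin m → ℝ) :
    eulerX (pdX A Φ) x p = (w - 1) * pdX A Φ x p := by
  have e := pdX_congr_of_ne_zero h A hx p
  rw [hΦ.pdX_const_mul w A hx p] at e
  have e' : pdX A (eulerX Φ) x p = pdX A Φ x p + ∑ B, x B * pdX A (pdX B Φ) x p :=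
    SmoothOffZero.pdX_sum_coord_mul (fun B => hΦ.partialX B) A hx p
  have e'' : ∑ B, x B * pdX A (pdX B Φ) x p = eulerX (pdX A Φ) x p :=
    Finset.sum_congr rfl fun B _ => by rw [hΦ.pdX_pdX_comm A B hx p]
  linarith

/-- If `X·∂_P Φ = 0`, then `X·∂_P` applied to a pure second derivative of `Φ` is a mixed
derivative. -/
theorem sum_coord_mul_pdP_pdX_pdX {m : ℕ} {Φ : (Fin m → ℝ) → (Fin m → ℝ) → ℝ}
    (hΦ : SmoothOffZero Φ) (h : ∀ x p : Fin m → ℝ, x ≠ 0 → ∑ B, x B * pdP B Φ x p = 0)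
    (A : Fin m) {x : Fin m → ℝ} (hx : x ≠ 0) (p : Fin m → ℝ) :
    ∑ B, x B * pdP B (pdX A (pdX A Φ)) x p = -2 * pdP A (pdX A Φ) x p := by
  have e1 : ∀ x p : Fin m → ℝ, x ≠ 0 →
      pdP A Φ x p + ∑ B, x B * pdP B (pdX A Φ) x p = 0 := fun x p hx => by
    have e := pdX_congr_of_ne_zero (Ψ := fun _ _ => 0) h A hx p
    rw [pdX_zero, SmoothOffZero.pdX_sum_coord_mul (fun B => hΦ.partialP B) A hx p] at e
    simpa only [hΦ.pdX_pdP_comm A _ hx p] using e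
  have e := pdX_congr_of_ne_zero (Ψ := fun _ _ => 0) e1 A hx p
  have hs := fun B => (hΦ.partialX A).partialP B
  rw [pdX_zero, (hΦ.partialP A).pdX_add (SmoothOffZero.sum_coord_mul hs) A hx p,
    SmoothOffZero.pdX_sum_coord_mul hs A hx p, hΦ.pdX_pdP_comm A A hx p] at e
  simp only [(hΦ.partialX A).pdX_pdP_comm A _ hx p] at e
  linarith

theorem pdP_lapX {m : ℕ} {Φ : (Fin m → ℝ) → (Fin m → ℝ) → ℝ} (hΦ : SmoothOffZero Φ)
    (ε : Fin m → ℝ) (B : Fin m) {x : Fin m → ℝ} (hx : x ≠ 0) (p : Fin m → ℝ) :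
    pdP B (lapX ε Φ) x p = ∑ A, ε A * pdP B (pdX A (pdX A Φ)) x p := by
  have hd : ∀ A, HasFDerivAt (fun p => ε A * pdX A (pdX A Φ) x p)
      (ε A • fderiv ℝ (pdX A (pdX A Φ) x) p) p := fun A =>
    (((hΦ.partialX A).partialX A).differentiableAt_right hx p).hasFDerivAt.const_mul (ε A)
  have := (HasFDerivAt.fun_sum (u := Finset.univ) fun A _ => hd A).fderiv
  simp only [pdP]
  rw [show lapX ε Φ x = fun p => ∑ A, ε A * pdX A (pdX A Φ) x p from rfl, this]
  simp

/-- `X·∂_P □_X Φ = -2 ∂_P·∂_X Φ` when `X·∂_P Φ = 0`. -/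
theorem sum_coord_mul_pdP_lapX {m : ℕ} {Φ : (Fin m → ℝ) → (Fin m → ℝ) → ℝ}
    (hΦ : SmoothOffZero Φ) (h : ∀ x p : Fin m → ℝ, x ≠ 0 → ∑ B, x B * pdP B Φ x p = 0)
    (ε : Fin m → ℝ) {x : Fin m → ℝ} (hx : x ≠ 0) (p : Fin m → ℝ) :
    ∑ B, x B * pdP B (lapX ε Φ) x p = -2 * ∑ A, ε A * pdP A (pdX A Φ) x p := by
  simp only [pdP_lapX hΦ ε _ hx p, Finset.mul_sum]
  rw [Finset.sum_comm]
  refine Finset.sum_congr rfl fun A _ => ?_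
  rw [mul_left_comm, ← sum_coord_mul_pdP_pdX_pdX hΦ h A hx p, Finset.mul_sum]
  exact Finset.sum_congr rfl fun B _ => mul_left_comm _ _ _

/-- The derivative `∂_{P^A}` of the Thomas-D operator on a function homogeneous in `X`. -/
theorem pdP_thomasDX_of_homogeneous {m : ℕ} {Φ : (Fin m → ℝ) → (Fin m → ℝ) → ℝ}
    (hΦ : SmoothOffZero Φ) {w : ℝ} (h : ∀ x p, x ≠ 0 → eulerX Φ x p = w * Φ x p)
    (ε : Fin m → ℝ) (c : ℝ) (A B : Fin m) {x : Fin m → ℝ} (hx : x ≠ 0) (p : Fin m → ℝ) :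
    pdP A (thomasDX ε c B Φ) x p
      = 2 * (w - 1 + c) * pdP A (pdX B Φ) x p - ε B * x B * pdP A (lapX ε Φ) x p := by
  have e : thomasDX ε c B Φ x
      = fun p => 2 * (w - 1 + c) * pdX B Φ x p - ε B * x B * lapX ε Φ x p := by
    funext p
    simp only [thomasDX]
    rw [eulerX_pdX_of_homogeneous hΦ h B hx p]
    ring
  have hl : DifferentiableAt ℝ (lapX ε Φ x) p :=
    DifferentiableAt.fun_sum fun A _ =>
      (((hΦ.partialX A).partialX A).differentiableAt_right hx p).const_mul (ε A)
  have := ((((hΦ.partialX B).differentiableAt_right hx p).hasFDerivAt.const_mul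
    (2 * (w - 1 + c))).sub (hl.hasFDerivAt.const_mul (ε B * x B))).fderiv
  rw [pdP, e]
  exact (DFunLike.congr_fun this (Pi.single A 1)).trans (by simp [pdP])

/-- if `X·∂_P Φ = 0` and `X·∂_X Φ = w Φ` on `(ℝ^{n+2} ∖ {0}) × ℝ^{n+2}`, then
`η^{AB} ∂_{P^A}(D_B Φ) = (2w + n) η^{AB} ∂_{P^A} ∂_{X^B} Φ` there. -/
theorem pdP_thomasDX_of_transverse
    (n : ℕ) (hn : 1 ≤ n) (ε : Fin (n + 2) → ℝ) (hsig : isSig ε 2)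
    (w : ℝ) (Φ : (Fin (n + 2) → ℝ) → (Fin (n + 2) → ℝ) → ℝ)
    (hΦ : ContDiffOn ℝ (⊤ : ℕ∞) (Function.uncurry Φ) {q : (Fin (n + 2) → ℝ) × (Fin (n + 2) → ℝ) | q.1 ≠ 0})
    (h1 : ∀ (x p : Fin (n + 2) → ℝ), x ≠ 0 → (∑ A, x A * pdP A Φ x p) = 0)
    (h2 : ∀ (x p : Fin (n + 2) → ℝ), x ≠ 0 → eulerX Φ x p = w * Φ x p) :
    ∀ (x p : Fin (n + 2) → ℝ), x ≠ 0 →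
      (∑ A, ε A * pdP A (thomasDX ε ((n : ℝ) / 2) A Φ) x p)
        = (2 * w + (n : ℝ)) * ∑ A, ε A * pdP A (pdX A Φ) x p := by
  intro x p hx
  have hs : SmoothOffZero Φ := fun x p hx =>
    hΦ.contDiffAt (eventually_fst_ne_zero hx p)
  have hε : ∀ A, ε A * ε A = 1 := fun A => by
    rcases hsig.1 A with h | h <;> simp [h]
  have key := sum_coord_mul_pdP_lapX hs h1 ε hx p
  have e : ∀ A, ε A * pdP A (thomasDX ε ((n : ℝ) / 2) A Φ) x p
      = 2 * (w - 1 + (n : ℝ) / 2) * (ε A * pdP A (pdX A Φ) x p)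
        - x A * pdP A (lapX ε Φ) x p := fun A => by
    rw [pdP_thomasDX_of_homogeneous hs h2 ε _ A A hx p]
    linear_combination (-(x A * pdP A (lapX ε Φ) x p)) * hε A
  simp only [e, Finset.sum_sub_distrib, ← Finset.mul_sum]
  rw [key]
  ring

end
end

section
/- Key identity for gauge invariance: fix a vector I ∈ ℝ^{n+2} and an integer t ≥ 1. As an operator identity on smooth functions Φ(X,P) on ℝ^{n+2} × ℝ^{n+2}, (I·D − (1/t)(P·D)(I·∂_P)) ∘ (P·D)^t = −(1/t) (P·D)^{t+1} ∘ (I·∂_P), where I·D = I^A D_A, P·D = η_{AB} P^A D^B (equivalently P_A D^A), I·∂_P = I^A ∂_{P^A}, and D acts in the X variable. -/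
noncomputable section

section ThomasAlgebra

variable {R : Type*} [Ring R]

/-- The relations between the Euler operator, the Laplacian, coordinates and derivatives under
which two components of the Thomas-D operator commute. -/
theorem commute_thomas_of_relations {F L y₁ y₂ d₁ d₂ g : R}
    (hyy : y₁ * y₂ = y₂ * y₁) (hdd : d₁ * d₂ = d₂ * d₁)
    (hdF₁ : d₁ * F = F * d₁ + d₁) (hdF₂ : d₂ * F = F * d₂ + d₂)
    (hFy₁ : F * y₁ = y₁ * F + y₁) (hFy₂ : F * y₂ = y₂ * F + y₂)
    (hLF : L * F = F * L + 2 * L)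
    (hLy₁ : L * y₁ = y₁ * L + 2 * d₁) (hLy₂ : L * y₂ = y₂ * L + 2 * d₂)
    (hLd₁ : L * d₁ = d₁ * L) (hLd₂ : L * d₂ = d₂ * L)
    (hdy₁ : d₁ * y₂ = y₂ * d₁ + g) (hdy₂ : d₂ * y₁ = y₁ * d₂ + g) :
    Commute (2 * (F * d₁) - y₁ * L) (2 * (F * d₂) - y₂ * L) := by
  have key : ∀ {y₁ y₂ d₁ d₂ : R}, d₁ * F = F * d₁ + d₁ → F * y₂ = y₂ * F + y₂ →
      L * y₂ = y₂ * L + 2 * d₂ → L * d₂ = d₂ * L → d₁ * y₂ = y₂ * d₁ + g →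
      (2 * (F * d₁) - y₁ * L) * (2 * (F * d₂) - y₂ * L) =
        4 * (F * F * (d₁ * d₂)) + 4 * (F * (d₁ * d₂)) - 2 * (y₂ * F * d₁ * L)
          - 2 * (y₂ * d₁ * L) - 2 * (F * g * L) - 2 * (y₁ * F * d₂ * L)
          - 4 * (y₁ * d₂ * L) + y₁ * y₂ * (L * L) + 2 * (y₁ * d₂ * L) := by
    intro y₁ y₂ d₁ d₂ hdF hFy hLy hLd hdy
    calc (2 * (F * d₁) - y₁ * L) * (2 * (F * d₂) - y₂ * L)
        = 4 * (F * (d₁ * F) * d₂) - 2 * (F * (d₁ * y₂) * L)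
          - 2 * (y₁ * (L * F) * d₂) + y₁ * (L * y₂) * L := by noncomm_ring
      _ = 4 * (F * F * (d₁ * d₂)) + 4 * (F * (d₁ * d₂)) - 2 * ((F * y₂) * d₁ * L)
          - 2 * (F * g * L) - 2 * (y₁ * F * (L * d₂)) - 4 * (y₁ * (L * d₂))
          + y₁ * y₂ * (L * L) + 2 * (y₁ * d₂ * L) := by
        rw [hdF, hdy, hLF, hLy]; noncomm_ring
      _ = _ := by rw [hFy, hLd]; noncomm_ring
  rw [Commute, SemiconjBy, key hdF₁ hFy₂ hLy₂ hLd₂ hdy₁, key hdF₂ hFy₁ hLy₁ hLd₁ hdy₂, hyy, hdd]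
  noncomm_ring

/-- If `z` commutes with `a` and `[v, a] = z`, then `v aᵗ = aᵗ v + t aᵗ⁻¹ z`, here
multiplied on the left by `a`. -/
theorem mul_mul_pow_of_commute {a v z : R} (hz : Commute z a) (hv : v * a = a * v + z) (t : ℕ) :
    a * (v * a ^ t) = a ^ (t + 1) * v + t * (z * a ^ t) := by
  induction t with
  | zero => simp
  | succ t ih =>
    have hzt := (hz.pow_right (t + 1)).eq
    calc a * (v * a ^ (t + 1)) = a * (v * a ^ t) * a := by rw [pow_succ]; noncomm_ring
      _ = a ^ (t + 1) * (v * a) + t * (z * (a ^ t * a)) := by rw [ih]; noncomm_ring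
      _ = a ^ (t + 1) * a * v + a ^ (t + 1) * z + t * (z * a ^ (t + 1)) := by
        rw [hv, ← pow_succ]; noncomm_ring
      _ = a ^ (t + 1 + 1) * v + (t + 1 : ℕ) * (z * a ^ (t + 1)) := by
        rw [← hzt, ← pow_succ]; push_cast; noncomm_ring

variable [Algebra ℝ R] {ι : Type*} [Fintype ι]

/-- The Thomas-D operator built from abstract coordinates `x` and derivatives `d`. -/
def thomas (x d : ι → R) (ε : ι → ℝ) (c : ℝ) (A : ι) : R :=
  2 * (((∑ B, x B * d B) + algebraMap ℝ R c) * d A)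
    - (ε A • x A) * ∑ B, ε B • (d B * d B)

theorem commute_thomas [DecidableEq ι] {x d : ι → R} {ε : ι → ℝ} (hε : ∀ A, ε A * ε A = 1) (c : ℝ)
    (hxx : ∀ A B, x A * x B = x B * x A) (hdd : ∀ A B, d A * d B = d B * d A)
    (hdx : ∀ A B, d A * x B = x B * d A + if A = B then 1 else 0) (A B : ι) :
    Commute (thomas x d ε c A) (thomas x d ε c B) := by
  have hc (a : R) : algebraMap ℝ R c * a = a * algebraMap ℝ R c := Algebra.commutes c a
  have hdF (A : ι) : d A * ((∑ B, x B * d B) + algebraMap ℝ R c)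
      = ((∑ B, x B * d B) + algebraMap ℝ R c) * d A + d A := by
    have h (B : ι) : d A * (x B * d B) = x B * d B * d A + if A = B then d B else 0 := by
      rw [← mul_assoc, hdx, add_mul, mul_assoc, hdd A B, ← mul_assoc, ite_mul, one_mul, zero_mul]
    rw [mul_add, add_mul, hc, Finset.mul_sum, Finset.sum_mul]
    simp only [h, Finset.sum_add_distrib, Finset.sum_ite_eq, Finset.mem_univ, if_true]
    abel
  have hFx (A : ι) : ((∑ B, x B * d B) + algebraMap ℝ R c) * x A
      = x A * ((∑ B, x B * d B) + algebraMap ℝ R c) + x A := by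
    have h (B : ι) : x B * d B * x A = x A * (x B * d B) + if B = A then x B else 0 := by
      rw [mul_assoc, hdx, mul_add, ← mul_assoc, hxx B A, mul_assoc, mul_ite, mul_one, mul_zero]
    rw [mul_add, add_mul, hc, Finset.mul_sum, Finset.sum_mul]
    simp only [h, Finset.sum_add_distrib, Finset.sum_ite_eq', Finset.mem_univ, if_true]
    abel
  have hLd (A : ι) : (∑ B, ε B • (d B * d B)) * d A = d A * ∑ B, ε B • (d B * d B) := by
    rw [Finset.sum_mul, Finset.mul_sum]
    refine Finset.sum_congr rfl fun B _ => ?_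
    rw [smul_mul_assoc, mul_smul_comm, mul_assoc, hdd B A, ← mul_assoc, hdd B A, mul_assoc]
  have hLF : (∑ B, ε B • (d B * d B)) * ((∑ B, x B * d B) + algebraMap ℝ R c)
      = ((∑ B, x B * d B) + algebraMap ℝ R c) * (∑ B, ε B • (d B * d B))
        + 2 * ∑ B, ε B • (d B * d B) := by
    generalize hF : (∑ B, x B * d B) + algebraMap ℝ R c = F at hdF
    have h (B : ι) : d B * d B * F = F * (d B * d B) + 2 * (d B * d B) := by
      rw [mul_assoc, hdF, mul_add, ← mul_assoc, hdF]
      noncomm_ring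
    rw [Finset.sum_mul, Finset.mul_sum, Finset.mul_sum, ← Finset.sum_add_distrib]
    refine Finset.sum_congr rfl fun B _ => ?_
    rw [smul_mul_assoc, mul_smul_comm, mul_smul_comm, h, smul_add]
  have hLy (A : ι) : (∑ B, ε B • (d B * d B)) * (ε A • x A)
      = (ε A • x A) * (∑ B, ε B • (d B * d B)) + 2 * d A := by
    have h (B : ι) : d B * d B * x A = x A * (d B * d B) + if B = A then 2 * d B else 0 := by
      rw [mul_assoc, hdx, mul_add, ← mul_assoc, hdx]
      split_ifs <;> noncomm_ring
    rw [mul_smul_comm, smul_mul_assoc, Finset.sum_mul, Finset.mul_sum]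
    simp only [smul_mul_assoc, h, mul_smul_comm, smul_add, Finset.sum_add_distrib, smul_ite,
      smul_zero, Finset.sum_ite_eq', Finset.mem_univ, if_true, smul_smul, hε, one_smul]
  have hdy (A B : ι) : d A * (ε B • x B) = (ε B • x B) * d A + if A = B then ε A • 1 else 0 := by
    rw [mul_smul_comm, hdx, smul_add, smul_mul_assoc]
    split_ifs with h
    · rw [h]
    · simp
  refine commute_thomas_of_relations (g := if A = B then ε A • 1 else 0) ?_ (hdd A B) (hdF A)
    (hdF B) ?_ ?_ hLF (hLy A) (hLy B) (hLd A) (hLd B) (hdy A B) ?_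
  · simp only [smul_mul_smul_comm, hxx A B, mul_comm (ε A)]
  · rw [mul_smul_comm, hFx, smul_add, smul_mul_assoc]
  · rw [mul_smul_comm, hFx, smul_add, smul_mul_assoc]
  · rw [hdy]
    split_ifs with h h' h'
    · rw [h]
    · exact absurd h.symm h'
    · exact absurd h'.symm h
    · rfl

/-- An element commuting with all `x A` and `d A` commutes with the Thomas-D operator. -/
theorem commute_thomas_of_commute {x d : ι → R} {a : R} (hx : ∀ A, Commute a (x A))
    (hd : ∀ A, Commute a (d A)) (ε : ι → ℝ) (c : ℝ) (A : ι) : Commute a (thomas x d ε c A) := by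
  rw [thomas]
  exact ((Commute.ofNat_right a 2).mul_right
    (((Commute.sum_right _ _ _ fun B _ => (hx B).mul_right (hd B)).add_right
      (Algebra.commutes c a).symm).mul_right (hd A))).sub_right
    (((hx A).smul_right _).mul_right
      (Commute.sum_right _ _ _ fun B _ => ((hd B).mul_right (hd B)).smul_right _))

end ThomasAlgebra

section SmoothOperators

variable (V : Type*) [NormedAddCommGroup V] [NormedSpace ℝ V]

/-- The space of smooth real functions on `V`. -/
def smoothFun : Submodule ℝ (V → ℝ) where
  carrier := {f | ContDiff ℝ (⊤ : ℕ∞) f}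
  add_mem' {f g} (hf : ContDiff ℝ (⊤ : ℕ∞) f) (hg : ContDiff ℝ (⊤ : ℕ∞) g) := hf.add hg
  zero_mem' := (contDiff_const : ContDiff ℝ (⊤ : ℕ∞) fun _ : V => (0 : ℝ))
  smul_mem' c f (hf : ContDiff ℝ (⊤ : ℕ∞) f) := hf.const_smul c

variable {V}

theorem contDiff_smoothFun (f : smoothFun V) : ContDiff ℝ (⊤ : ℕ∞) f.1 := f.2

theorem differentiable_smoothFun (f : smoothFun V) : Differentiable ℝ f.1 :=
  (contDiff_smoothFun f).differentiable (by simp)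

theorem contDiff_fderiv_smoothFun (f : smoothFun V) : ContDiff ℝ (⊤ : ℕ∞) (fderiv ℝ f.1) :=
  (contDiff_smoothFun f).fderiv_right (by simp)

/-- Multiplication by a linear form. -/
def mulOp (l : V →L[ℝ] ℝ) : Module.End ℝ (smoothFun V) where
  toFun f := ⟨fun z => l z * f.1 z, l.contDiff.mul (contDiff_smoothFun f)⟩
  map_add' f g := by ext z; exact mul_add _ _ _
  map_smul' c f := by ext z; exact mul_left_comm _ _ _

/-- The derivative in a fixed direction. -/
def dirOp (v : V) : Module.End ℝ (smoothFun V) where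
  toFun f := ⟨fun z => fderiv ℝ f.1 z v,
    (contDiff_fderiv_smoothFun f).clm_apply contDiff_const⟩
  map_add' f g := by
    ext z
    change fderiv ℝ (f.1 + g.1) z v = _
    rw [fderiv_add (differentiable_smoothFun f z) (differentiable_smoothFun g z)]
    rfl
  map_smul' c f := by
    ext z
    change fderiv ℝ (c • f.1) z v = _
    rw [fderiv_const_smul (differentiable_smoothFun f z)]
    rfl

theorem mulOp_mul_comm (l k : V →L[ℝ] ℝ) : mulOp l * mulOp k = mulOp k * mulOp l := by
  ext f z
  exact mul_left_comm _ _ _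

theorem dirOp_mul_comm (v w : V) : dirOp v * dirOp w = dirOp w * dirOp v := by
  ext f z
  have hd : DifferentiableAt ℝ (fderiv ℝ f.1) z :=
    (contDiff_fderiv_smoothFun f).differentiable (by simp) z
  have h (v w : V) : ((dirOp v * dirOp w) f).1 z = fderiv ℝ (fderiv ℝ f.1) z v w := by
    change fderiv ℝ (fun y => fderiv ℝ f.1 y w) z v = _
    rw [fderiv_clm_apply hd (differentiableAt_const w)]
    simp
  rw [h, h]
  refine ((contDiff_smoothFun f).contDiffAt.isSymmSndFDerivAt ?_).eq v w
  rw [minSmoothness_of_isRCLikeNormedField]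
  exact WithTop.coe_le_coe.2 (le_top : (2 : ℕ∞) ≤ ⊤)

theorem dirOp_mul_mulOp (v : V) (l : V →L[ℝ] ℝ) :
    dirOp v * mulOp l = mulOp l * dirOp v + algebraMap ℝ _ (l v) := by
  ext f z
  change fderiv ℝ (fun y => l y * f.1 y) z v = l z * fderiv ℝ f.1 z v + l v * f.1 z
  rw [fderiv_fun_mul l.differentiableAt (differentiable_smoothFun f z)]
  simp [mul_comm]

end SmoothOperators

section AmbientOperators

variable {m : ℕ}

/-- Multiplication by the coordinate `X^A`. -/
def coordX (A : Fin m) : Module.End ℝ (smoothFun ((Fin m → ℝ) × (Fin m → ℝ))) :=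
  mulOp ((ContinuousLinearMap.proj A).comp (ContinuousLinearMap.fst ℝ _ _))

/-- Multiplication by the coordinate `P^A`. -/
def coordP (A : Fin m) : Module.End ℝ (smoothFun ((Fin m → ℝ) × (Fin m → ℝ))) :=
  mulOp ((ContinuousLinearMap.proj A).comp (ContinuousLinearMap.snd ℝ _ _))

/-- The partial derivative `∂_{X^A}` on smooth functions. -/
def derivX (A : Fin m) : Module.End ℝ (smoothFun ((Fin m → ℝ) × (Fin m → ℝ))) :=
  dirOp (Pi.single A 1, 0)

/-- The partial derivative `∂_{P^A}` on smooth functions. -/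
def derivP (A : Fin m) : Module.End ℝ (smoothFun ((Fin m → ℝ) × (Fin m → ℝ))) :=
  dirOp (0, Pi.single A 1)

theorem derivX_mul_coordX (A B : Fin m) :
    derivX A * coordX B = coordX B * derivX A + if A = B then 1 else 0 := by
  rw [derivX, coordX, dirOp_mul_mulOp]
  by_cases h : A = B
  · simp [h]
  · simp [h, Ne.symm h]

theorem derivP_mul_coordP (A B : Fin m) :
    derivP A * coordP B = coordP B * derivP A + if A = B then 1 else 0 := by
  rw [derivP, coordP, dirOp_mul_mulOp]
  by_cases h : A = B
  · simp [h]
  · simp [h, Ne.symm h]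

theorem commute_derivX_coordP (A B : Fin m) : Commute (derivX A) (coordP B) := by
  rw [Commute, SemiconjBy, derivX, coordP, dirOp_mul_mulOp]
  simp

theorem commute_derivP_coordX (A B : Fin m) : Commute (derivP A) (coordX B) := by
  rw [Commute, SemiconjBy, derivP, coordX, dirOp_mul_mulOp]
  simp

/-- The operator `P·D` on smooth functions. -/
def smoothPD (ε : Fin m → ℝ) (c : ℝ) : Module.End ℝ (smoothFun ((Fin m → ℝ) × (Fin m → ℝ))) :=
  ∑ A, coordP A * thomas coordX derivX ε c A

/-- The operator `I·D` on smooth functions. -/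
def smoothID (ε : Fin m → ℝ) (c : ℝ) (I : Fin m → ℝ) :
    Module.End ℝ (smoothFun ((Fin m → ℝ) × (Fin m → ℝ))) :=
  ∑ A, I A • thomas coordX derivX ε c A

/-- The operator `I·∂_P` on smooth functions. -/
def smoothIdP (I : Fin m → ℝ) : Module.End ℝ (smoothFun ((Fin m → ℝ) × (Fin m → ℝ))) :=
  ∑ A, I A • derivP A

theorem commute_coordP_thomas (ε : Fin m → ℝ) (c : ℝ) (A B : Fin m) :
    Commute (coordP A) (thomas coordX derivX ε c B) := by
  have hx (B : Fin m) : Commute (coordP A) (coordX B) := mulOp_mul_comm _ _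
  exact commute_thomas_of_commute hx (fun B => (commute_derivX_coordP B A).symm) ε c B

theorem commute_derivP_thomas (ε : Fin m → ℝ) (c : ℝ) (A B : Fin m) :
    Commute (derivP A) (thomas coordX derivX ε c B) := by
  have hd (B : Fin m) : Commute (derivP A) (derivX B) := dirOp_mul_comm _ _
  exact commute_thomas_of_commute (commute_derivP_coordX A) hd ε c B

theorem commute_smoothID_smoothPD {ε : Fin m → ℝ} (hε : ∀ A, ε A * ε A = 1) (c : ℝ)
    (I : Fin m → ℝ) : Commute (smoothID ε c I) (smoothPD ε c) :=
  Commute.sum_left _ _ _ fun A _ => Commute.sum_right _ _ _ fun B _ =>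
    ((commute_coordP_thomas ε c B A).symm.mul_right
      (commute_thomas hε c (fun _ _ => mulOp_mul_comm _ _) (fun _ _ => dirOp_mul_comm _ _)
        derivX_mul_coordX A B)).smul_left _

theorem smoothIdP_mul_smoothPD (ε : Fin m → ℝ) (c : ℝ) (I : Fin m → ℝ) :
    smoothIdP I * smoothPD ε c = smoothPD ε c * smoothIdP I + smoothID ε c I := by
  have h (A B : Fin m) : derivP A * (coordP B * thomas coordX derivX ε c B)
      = coordP B * thomas coordX derivX ε c B * derivP A
        + if A = B then thomas coordX derivX ε c B else 0 := by
    rw [← mul_assoc, derivP_mul_coordP, add_mul, mul_assoc, (commute_derivP_thomas ε c A B).eq,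
      ← mul_assoc, ite_mul, one_mul, zero_mul]
  have hA (A : Fin m) : derivP A * smoothPD ε c
      = smoothPD ε c * derivP A + thomas coordX derivX ε c A := by
    simp only [smoothPD, Finset.mul_sum, Finset.sum_mul, h, Finset.sum_add_distrib,
      Finset.sum_ite_eq, Finset.mem_univ, if_true]
  simp only [smoothIdP, smoothID, Finset.sum_mul, Finset.mul_sum, smul_mul_assoc, mul_smul_comm,
    hA, smul_add, Finset.sum_add_distrib]

/-- The two-argument form of a smooth function on the product. -/
def curryFun (f : smoothFun ((Fin m → ℝ) × (Fin m → ℝ))) : (Fin m → ℝ) → (Fin m → ℝ) → ℝ :=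
  fun x p => f.1 (x, p)

theorem pdX_curryFun (A : Fin m) (f : smoothFun ((Fin m → ℝ) × (Fin m → ℝ))) :
    pdX A (curryFun f) = curryFun (derivX A f) := by
  funext x p
  have h : HasFDerivAt (f.1 ∘ fun y => (y, p)) _ x :=
    HasFDerivAt.comp x (differentiable_smoothFun f (x, p)).hasFDerivAt
      (hasFDerivAt_prodMk_left x p)
  change fderiv ℝ (f.1 ∘ fun y => (y, p)) x (Pi.single A 1) = _
  rw [h.fderiv]
  rfl

theorem pdP_curryFun (A : Fin m) (f : smoothFun ((Fin m → ℝ) × (Fin m → ℝ))) :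
    pdP A (curryFun f) = curryFun (derivP A f) := by
  funext x p
  have h : HasFDerivAt (f.1 ∘ fun y => (x, y)) _ p :=
    HasFDerivAt.comp p (differentiable_smoothFun f (x, p)).hasFDerivAt
      (hasFDerivAt_prodMk_right x p)
  change fderiv ℝ (f.1 ∘ fun y => (x, y)) p (Pi.single A 1) = _
  rw [h.fderiv]
  rfl

theorem sum_apply_curryFun (T : Fin m → Module.End ℝ (smoothFun ((Fin m → ℝ) × (Fin m → ℝ))))
    (f : smoothFun ((Fin m → ℝ) × (Fin m → ℝ))) (x p : Fin m → ℝ) :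
    curryFun ((∑ A, T A) f) x p = ∑ A, curryFun (T A f) x p := by
  simp [curryFun, LinearMap.sum_apply]

theorem thomasDX_curryFun (ε : Fin m → ℝ) (c : ℝ) (A : Fin m)
    (f : smoothFun ((Fin m → ℝ) × (Fin m → ℝ))) :
    thomasDX ε c A (curryFun f) = curryFun (thomas coordX derivX ε c A f) := by
  funext x p
  have hE (g : smoothFun ((Fin m → ℝ) × (Fin m → ℝ))) :
      eulerX (curryFun g) x p = curryFun ((∑ B, coordX B * derivX B) g) x p := by
    simp only [eulerX, sum_apply_curryFun, pdX_curryFun]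
    rfl
  have hL : lapX ε (curryFun f) x p
      = curryFun ((∑ B, ε B • (derivX B * derivX B)) f) x p := by
    simp only [lapX, sum_apply_curryFun, pdX_curryFun]
    rfl
  rw [thomasDX, pdX_curryFun, hE, hL, thomas, two_mul, two_mul, add_mul, mul_assoc (ε A)]
  rfl

theorem opPD_curryFun (ε : Fin m → ℝ) (c : ℝ) (f : smoothFun ((Fin m → ℝ) × (Fin m → ℝ))) :
    opPD ε c (curryFun f) = curryFun (smoothPD ε c f) := by
  funext x p
  simp only [opPD, smoothPD, sum_apply_curryFun, thomasDX_curryFun]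
  rfl

theorem opID_curryFun (ε : Fin m → ℝ) (c : ℝ) (I : Fin m → ℝ)
    (f : smoothFun ((Fin m → ℝ) × (Fin m → ℝ))) :
    opID ε c I (curryFun f) = curryFun (smoothID ε c I f) := by
  funext x p
  simp only [opID, smoothID, sum_apply_curryFun, thomasDX_curryFun]
  rfl

theorem opIdP_curryFun (I : Fin m → ℝ) (f : smoothFun ((Fin m → ℝ) × (Fin m → ℝ))) :
    opIdP I (curryFun f) = curryFun (smoothIdP I f) := by
  funext x p
  simp only [opIdP, smoothIdP, sum_apply_curryFun, pdP_curryFun]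
  rfl

theorem iterate_opPD_curryFun (ε : Fin m → ℝ) (c : ℝ) (t : ℕ)
    (f : smoothFun ((Fin m → ℝ) × (Fin m → ℝ))) :
    (opPD ε c)^[t] (curryFun f) = curryFun ((smoothPD ε c ^ t) f) := by
  rw [Module.End.pow_apply]
  exact ((Function.Semiconj.iterate_right (f := curryFun)
    (fun g => (opPD_curryFun ε c g).symm) t) f).symm

end AmbientOperators

/-- key identity for gauge invariance: as an operator identity on smooth
functions of `(X,P)`, `(I·D - (1/t)(P·D)(I·∂_P)) ∘ (P·D)^t = -(1/t) (P·D)^{t+1} ∘ (I·∂_P)`. -/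
theorem key_gauge_identity
    (n : ℕ) (hn : 1 ≤ n) (ε : Fin (n + 2) → ℝ) (hsig : isSig ε 2)
    (I : Fin (n + 2) → ℝ) (t : ℕ) (ht : 1 ≤ t) :
    ∀ Φ : (Fin (n + 2) → ℝ) → (Fin (n + 2) → ℝ) → ℝ,
      ContDiff ℝ (⊤ : ℕ∞) (Function.uncurry Φ) →
      ∀ (x p : Fin (n + 2) → ℝ),
        opID ε ((n : ℝ) / 2) I ((opPD ε ((n : ℝ) / 2))^[t] Φ) x p
          - (1 / (t : ℝ)) *
              opPD ε ((n : ℝ) / 2) (opIdP I ((opPD ε ((n : ℝ) / 2))^[t] Φ)) x p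
        = -(1 / (t : ℝ)) * (opPD ε ((n : ℝ) / 2))^[t + 1] (opIdP I Φ) x p := by
  intro Φ hΦ x p
  have hε (A : Fin (n + 2)) : ε A * ε A = 1 := by
    rcases hsig.1 A with h | h <;> simp [h]
  obtain ⟨f, rfl⟩ : ∃ f, Φ = curryFun f := ⟨⟨Function.uncurry Φ, hΦ⟩, rfl⟩
  rw [iterate_opPD_curryFun, opID_curryFun, opIdP_curryFun, opPD_curryFun, opIdP_curryFun,
    iterate_opPD_curryFun]
  have h := congrArg (fun T : Module.End ℝ (smoothFun _) => curryFun (T f) x p)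
    (mul_mul_pow_of_commute (commute_smoothID_smoothPD hε ((n : ℝ) / 2) I)
      (smoothIdP_mul_smoothPD ε ((n : ℝ) / 2) I) t)
  rw [← nsmul_eq_mul, ← Nat.cast_smul_eq_nsmul ℝ] at h
  change curryFun (smoothPD ε ((n : ℝ) / 2) (smoothIdP I ((smoothPD ε ((n : ℝ) / 2) ^ t) f))) x p
    = curryFun ((smoothPD ε ((n : ℝ) / 2) ^ (t + 1)) (smoothIdP I f)) x p
      + (t : ℝ) * curryFun (smoothID ε ((n : ℝ) / 2) I ((smoothPD ε ((n : ℝ) / 2) ^ t) f)) x p at h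
  have ht' : (t : ℝ) ≠ 0 := by positivity
  rw [h]
  field_simp
  ring

end
end

section
/- Gauge invariance of the factorized conformal higher spin operator (flat ambient form): fix a vector I ∈ ℝ^{n+2}, integers s ≥ 1 and 1 ≤ t ≤ s, and an integer ℓ ≥ s − t + 1. Let ε(X,P) be a smooth function on ℝ^{n+2} × ℝ^{n+2} that is polynomial in P of degree at most s − t (i.e. all partial derivatives of ε of order s − t + 1 with respect to the P-variables vanish identically). With 𝔅_j := I·D − (1/j)(P·D)(I·∂_P), one has 𝔅_{t+ℓ−1} ∘ 𝔅_{t+ℓ−2} ∘ ⋯ ∘ 𝔅_t ((P·D)^t ε) = 0. -/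
noncomputable section

/-- The operator `𝔅_j = I·D - (1/j)(P·D)(I·∂_P)`. -/
def opB {m : ℕ} (ε : Fin m → ℝ) (c : ℝ) (I : Fin m → ℝ) (j : ℕ)
    (Φ : (Fin m → ℝ) → (Fin m → ℝ) → ℝ) : (Fin m → ℝ) → (Fin m → ℝ) → ℝ :=
  fun x p => opID ε c I Φ x p - (1 / (j : ℝ)) * opPD ε c (opIdP I Φ) x p

/-- The composition `𝔅_{t+k-1} ∘ 𝔅_{t+k-2} ∘ ⋯ ∘ 𝔅_t` (`k` factors). -/
def opBcomp {m : ℕ} (ε : Fin m → ℝ) (c : ℝ) (I : Fin m → ℝ) (t : ℕ) :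
    ℕ → ((Fin m → ℝ) → (Fin m → ℝ) → ℝ) → (Fin m → ℝ) → (Fin m → ℝ) → ℝ
  | 0, Φ => Φ
  | k + 1, Φ => opB ε c I (t + k) (opBcomp ε c I t k Φ)

/-- Iterated `P`-derivative along a list of indices. -/
def pdPList {m : ℕ} : List (Fin m) → ((Fin m → ℝ) → (Fin m → ℝ) → ℝ) →
    (Fin m → ℝ) → (Fin m → ℝ) → ℝ
  | [], Φ => Φ
  | A :: As, Φ => pdP A (pdPList As Φ)

/-- The space of smooth functions `Φ(X,P)`. -/
def smoothXP (m : ℕ) : Submodule ℝ ((Fin m → ℝ) → (Fin m → ℝ) → ℝ) where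
  carrier := {Φ | ContDiff ℝ (⊤ : ℕ∞) (Function.uncurry Φ)}
  add_mem' ha hb := Set.mem_ofPred.mpr (ContDiff.add (Set.mem_ofPred.mp ha) (Set.mem_ofPred.mp hb))
  zero_mem' := Set.mem_ofPred.mpr contDiff_const
  smul_mem' c _ ha := Set.mem_ofPred.mpr (ContDiff.const_smul c (Set.mem_ofPred.mp ha))

namespace smoothXP

variable {m : ℕ}

theorem mem_iff {Φ : (Fin m → ℝ) → (Fin m → ℝ) → ℝ} :
    Φ ∈ smoothXP m ↔ ContDiff ℝ (⊤ : ℕ∞) (Function.uncurry Φ) := Iff.rfl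

theorem contDiff (f : smoothXP m) : ContDiff ℝ (⊤ : ℕ∞) (Function.uncurry f.1) :=
  mem_iff.mp f.2

theorem differentiable (f : smoothXP m) : Differentiable ℝ (Function.uncurry f.1) :=
  (contDiff f).differentiable (by simp)

/-- The directional derivative along `v` as an operator on smooth functions of `(X,P)`. -/
def dir (v : (Fin m → ℝ) × (Fin m → ℝ)) : smoothXP m →ₗ[ℝ] smoothXP m where
  toFun f := ⟨fun x p => fderiv ℝ (Function.uncurry f.1) (x, p) v, by
    have h : ContDiff ℝ (⊤ : ℕ∞) (fderiv ℝ (Function.uncurry f.1)) :=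
      (contDiff f).fderiv_right (by simp)
    exact mem_iff.mpr (h.clm_apply contDiff_const)⟩
  map_add' f g := by
    ext x p
    have : Function.uncurry (f + g).1 = Function.uncurry f.1 + Function.uncurry g.1 := rfl
    simp only [this, fderiv_add (differentiable f _) (differentiable g _)]
    rfl
  map_smul' c f := by
    ext x p
    have : Function.uncurry (c • f).1 = c • Function.uncurry f.1 := rfl
    simp only [this, fderiv_const_smul (differentiable f _)]
    rfl

/-- Multiplication by the linear function `φ`, as an operator on smooth functions of `(X,P)`. -/
def mul (φ : (Fin m → ℝ) × (Fin m → ℝ) →L[ℝ] ℝ) : smoothXP m →ₗ[ℝ] smoothXP m where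
  toFun f := ⟨fun x p => φ (x, p) * f.1 x p, mem_iff.mpr (φ.contDiff.mul (contDiff f))⟩
  map_add' f g := by
    ext x p
    exact mul_add _ _ _
  map_smul' c f := by
    ext x p
    exact mul_left_comm _ _ _

theorem dir_apply (v : (Fin m → ℝ) × (Fin m → ℝ)) (f : smoothXP m) (x p : Fin m → ℝ) :
    (dir v f).1 x p = fderiv ℝ (Function.uncurry f.1) (x, p) v := rfl

theorem mul_apply (φ : (Fin m → ℝ) × (Fin m → ℝ) →L[ℝ] ℝ) (f : smoothXP m)
    (x p : Fin m → ℝ) : (mul φ f).1 x p = φ (x, p) * f.1 x p := rfl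

theorem sum_apply (g : Fin m → smoothXP m) (x p : Fin m → ℝ) :
    (∑ A, g A).1 x p = ∑ A, (g A).1 x p := by
  simp [Finset.sum_apply]

theorem dir_comm (v w : (Fin m → ℝ) × (Fin m → ℝ)) (f : smoothXP m) :
    dir v (dir w f) = dir w (dir v f) := by
  have h : Differentiable ℝ (fderiv ℝ (Function.uncurry f.1)) :=
    ((contDiff f).fderiv_right (m := 1) (by norm_cast)).differentiable (by simp)
  have key (v w : (Fin m → ℝ) × (Fin m → ℝ)) (z : (Fin m → ℝ) × (Fin m → ℝ)) :
      (dir v (dir w f)).1 z.1 z.2 = fderiv ℝ (fderiv ℝ (Function.uncurry f.1)) z v w := by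
    have hu : Function.uncurry (dir w f).1 = fun z => fderiv ℝ (Function.uncurry f.1) z w := rfl
    rw [dir_apply, hu, fderiv_clm_apply (h _) (differentiableAt_const _)]
    simp
  ext x p
  have hsymm : IsSymmSndFDerivAt ℝ (Function.uncurry f.1) (x, p) :=
    (contDiff f).contDiffAt.isSymmSndFDerivAt (by simp; norm_cast)
  rw [key v w (x, p), key w v (x, p), hsymm.eq]

theorem dir_mul (v : (Fin m → ℝ) × (Fin m → ℝ)) (φ : (Fin m → ℝ) × (Fin m → ℝ) →L[ℝ] ℝ)
    (f : smoothXP m) : dir v (mul φ f) = mul φ (dir v f) + φ v • f := by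
  ext x p
  have hu : Function.uncurry (mul φ f).1 = fun z => φ z * Function.uncurry f.1 z := rfl
  rw [dir_apply, hu, fderiv_fun_mul φ.differentiableAt (differentiable f _)]
  simp [dir_apply, mul_apply]
  ring

theorem mul_comm (φ ψ : (Fin m → ℝ) × (Fin m → ℝ) →L[ℝ] ℝ) (f : smoothXP m) :
    mul φ (mul ψ f) = mul ψ (mul φ f) := by
  ext x p
  exact mul_left_comm _ _ _

/-- The coordinate function `X^A`. -/
def coordX (A : Fin m) : (Fin m → ℝ) × (Fin m → ℝ) →L[ℝ] ℝ :=
  (ContinuousLinearMap.proj A).comp (ContinuousLinearMap.fst ℝ _ _)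

/-- The coordinate function `P^A`. -/
def coordP (A : Fin m) : (Fin m → ℝ) × (Fin m → ℝ) →L[ℝ] ℝ :=
  (ContinuousLinearMap.proj A).comp (ContinuousLinearMap.snd ℝ _ _)

/-- The operator `∂_{X^A}` on smooth functions. -/
def dX (A : Fin m) : smoothXP m →ₗ[ℝ] smoothXP m := dir (Pi.single A 1, 0)

/-- The operator `∂_{P^A}` on smooth functions. -/
def dP (A : Fin m) : smoothXP m →ₗ[ℝ] smoothXP m := dir (0, Pi.single A 1)

/-- The Euler operator `X·∂_X` on smooth functions. -/
def euler : smoothXP m →ₗ[ℝ] smoothXP m := ∑ A, mul (coordX A) ∘ₗ dX A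

/-- The Laplacian `□_X` on smooth functions. -/
def lap (ε : Fin m → ℝ) : smoothXP m →ₗ[ℝ] smoothXP m := ∑ A, ε A • (dX A ∘ₗ dX A)

/-- The Thomas-D operator on smooth functions. -/
def thomas (ε : Fin m → ℝ) (c : ℝ) (A : Fin m) : smoothXP m →ₗ[ℝ] smoothXP m :=
  (2 : ℝ) • (euler ∘ₗ dX A + c • dX A) - ε A • (mul (coordX A) ∘ₗ lap ε)

/-- The operator `P·D` on smooth functions. -/
def PD (ε : Fin m → ℝ) (c : ℝ) : smoothXP m →ₗ[ℝ] smoothXP m :=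
  ∑ A, mul (coordP A) ∘ₗ thomas ε c A

/-- The operator `I·D` on smooth functions. -/
def ID (ε : Fin m → ℝ) (c : ℝ) (I : Fin m → ℝ) : smoothXP m →ₗ[ℝ] smoothXP m :=
  ∑ A, I A • thomas ε c A

/-- The operator `I·∂_P` on smooth functions. -/
def IdP (I : Fin m → ℝ) : smoothXP m →ₗ[ℝ] smoothXP m := ∑ A, I A • dP A

theorem coe_dX (A : Fin m) (f : smoothXP m) : (dX A f).1 = pdX A f.1 := by
  ext x p
  have h := (differentiable f (x, p)).hasFDerivAt.comp x
    (hasFDerivAt_prodMk_left (𝕜 := ℝ) x p)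
  have h2 : (fun y => f.1 y p) = Function.uncurry f.1 ∘ fun y => (y, p) := rfl
  rw [pdX, h2, h.fderiv]
  simp [dX, dir_apply]

theorem coe_dP (A : Fin m) (f : smoothXP m) : (dP A f).1 = pdP A f.1 := by
  ext x p
  have h := (differentiable f (x, p)).hasFDerivAt.comp p
    (hasFDerivAt_prodMk_right (𝕜 := ℝ) x p)
  have h2 : f.1 x = Function.uncurry f.1 ∘ fun q => (x, q) := rfl
  rw [pdP, h2, h.fderiv]
  simp [dP, dir_apply]

theorem coe_euler (f : smoothXP m) : (euler f).1 = eulerX f.1 := by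
  ext x p
  simp only [euler, LinearMap.sum_apply, sum_apply, LinearMap.comp_apply, mul_apply, coe_dX]
  rfl

theorem coe_lap (ε : Fin m → ℝ) (f : smoothXP m) : (lap ε f).1 = lapX ε f.1 := by
  ext x p
  simp only [lap, LinearMap.sum_apply, sum_apply, LinearMap.comp_apply, LinearMap.smul_apply,
    SetLike.val_smul, Pi.smul_apply, coe_dX]
  rfl

theorem coe_thomas (ε : Fin m → ℝ) (c : ℝ) (A : Fin m) (f : smoothXP m) :
    (thomas ε c A f).1 = thomasDX ε c A f.1 := by
  ext x p
  simp only [thomas, thomasDX, ← coe_dX, ← coe_euler, ← coe_lap, mul_assoc]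
  rfl

theorem coe_PD (ε : Fin m → ℝ) (c : ℝ) (f : smoothXP m) : (PD ε c f).1 = opPD ε c f.1 := by
  ext x p
  simp only [PD, LinearMap.sum_apply, sum_apply, LinearMap.comp_apply, mul_apply, coe_thomas]
  rfl

theorem coe_ID (ε : Fin m → ℝ) (c : ℝ) (I : Fin m → ℝ) (f : smoothXP m) :
    (ID ε c I f).1 = opID ε c I f.1 := by
  ext x p
  simp only [ID, LinearMap.sum_apply, sum_apply, LinearMap.smul_apply,
    SetLike.val_smul, Pi.smul_apply, coe_thomas]
  rfl

theorem coe_IdP (I : Fin m → ℝ) (f : smoothXP m) : (IdP I f).1 = opIdP I f.1 := by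
  ext x p
  simp only [IdP, LinearMap.sum_apply, sum_apply, LinearMap.smul_apply,
    SetLike.val_smul, Pi.smul_apply, coe_dP]
  rfl

theorem coe_PD_iterate (ε : Fin m → ℝ) (c : ℝ) (t : ℕ) (f : smoothXP m) :
    ((PD ε c ^ t) f).1 = (opPD ε c)^[t] f.1 := by
  induction t with
  | zero => rfl
  | succ t ih => rw [pow_succ', Function.iterate_succ_apply', ← ih, ← coe_PD]; rfl

theorem coordX_single (A B : Fin m) :
    coordX A (Pi.single B 1, 0) = if A = B then 1 else 0 := by
  simp [coordX, Pi.single_apply]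

theorem dX_mul_coordX (A B : Fin m) (f : smoothXP m) :
    dX A (mul (coordX B) f) = mul (coordX B) (dX A f) + (if B = A then (1 : ℝ) else 0) • f := by
  rw [dX, dir_mul, coordX_single]

theorem dP_mul_coordX (A B : Fin m) (f : smoothXP m) :
    dP A (mul (coordX B) f) = mul (coordX B) (dP A f) := by
  simp [dP, dir_mul, coordX]

theorem dP_mul_coordP (A B : Fin m) (f : smoothXP m) :
    dP A (mul (coordP B) f) = mul (coordP B) (dP A f) + (if B = A then (1 : ℝ) else 0) • f := by
  simp [dP, dir_mul, coordP, Pi.single_apply]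

theorem dX_mul_coordP (A B : Fin m) (f : smoothXP m) :
    dX A (mul (coordP B) f) = mul (coordP B) (dX A f) := by
  simp [dX, dir_mul, coordP]

theorem dX_euler (A : Fin m) (f : smoothXP m) : dX A (euler f) = euler (dX A f) + dX A f := by
  simp only [euler, LinearMap.sum_apply, LinearMap.comp_apply, map_sum, dX_mul_coordX,
    Finset.sum_add_distrib, ite_smul, one_smul, zero_smul, Finset.sum_ite_eq', Finset.mem_univ,
    if_true]
  congr 1
  refine Finset.sum_congr rfl fun B _ => ?_
  rw [dX, dX, dir_comm]

theorem dX_lap (ε : Fin m → ℝ) (A : Fin m) (f : smoothXP m) :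
    dX A (lap ε f) = lap ε (dX A f) := by
  simp only [lap, LinearMap.sum_apply, LinearMap.comp_apply, LinearMap.smul_apply, map_sum,
    map_smul]
  refine Finset.sum_congr rfl fun B _ => ?_
  simp only [dX, dir_comm (Pi.single A 1, 0)]

theorem euler_mul_coordX (A : Fin m) (f : smoothXP m) :
    euler (mul (coordX A) f) = mul (coordX A) (euler f) + mul (coordX A) f := by
  simp only [euler, LinearMap.sum_apply, LinearMap.comp_apply, dX_mul_coordX, map_sum, map_add,
    Finset.sum_add_distrib, ite_smul, one_smul, zero_smul, mul_comm (coordX A)]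
  simp [apply_ite]

theorem euler_mul_coordP (A : Fin m) (f : smoothXP m) :
    euler (mul (coordP A) f) = mul (coordP A) (euler f) := by
  simp only [euler, LinearMap.sum_apply, LinearMap.comp_apply, dX_mul_coordP, map_sum,
    mul_comm (coordP A)]

theorem lap_mul_coordP (ε : Fin m → ℝ) (A : Fin m) (f : smoothXP m) :
    lap ε (mul (coordP A) f) = mul (coordP A) (lap ε f) := by
  simp only [lap, LinearMap.sum_apply, LinearMap.comp_apply, LinearMap.smul_apply,
    dX_mul_coordP, map_sum, map_smul]

theorem lap_mul_coordX (ε : Fin m → ℝ) (A : Fin m) (f : smoothXP m) :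
    lap ε (mul (coordX A) f) = mul (coordX A) (lap ε f) + (2 * ε A) • dX A f := by
  have h (B : Fin m) : ε B • dX B (dX B (mul (coordX A) f)) =
      mul (coordX A) (ε B • dX B (dX B f)) + if A = B then (2 * ε B) • dX B f else 0 := by
    simp only [dX_mul_coordX, map_add, map_smul]
    split_ifs <;> module
  simp only [lap, LinearMap.sum_apply, LinearMap.comp_apply, LinearMap.smul_apply, h,
    Finset.sum_add_distrib, map_sum]
  simp

theorem lap_euler (ε : Fin m → ℝ) (f : smoothXP m) :
    lap ε (euler f) = euler (lap ε f) + (2 : ℝ) • lap ε f := by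
  simp only [lap, LinearMap.sum_apply, LinearMap.comp_apply, LinearMap.smul_apply, map_sum,
    map_smul, dX_euler, map_add, Finset.smul_sum, ← Finset.sum_add_distrib]
  refine Finset.sum_congr rfl fun B _ => ?_
  module

theorem dP_euler (A : Fin m) (f : smoothXP m) : dP A (euler f) = euler (dP A f) := by
  simp only [euler, LinearMap.sum_apply, LinearMap.comp_apply, map_sum, dP_mul_coordX]
  refine Finset.sum_congr rfl fun B _ => ?_
  rw [dX, dP, dir_comm]

theorem dP_dX (A B : Fin m) (f : smoothXP m) : dP A (dX B f) = dX B (dP A f) :=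
  dir_comm _ _ f

theorem dP_lap (ε : Fin m → ℝ) (A : Fin m) (f : smoothXP m) :
    dP A (lap ε f) = lap ε (dP A f) := by
  simp only [lap, LinearMap.sum_apply, LinearMap.comp_apply, LinearMap.smul_apply, map_sum,
    map_smul, dP_dX]

theorem dP_thomas (ε : Fin m → ℝ) (c : ℝ) (A B : Fin m) (f : smoothXP m) :
    dP A (thomas ε c B f) = thomas ε c B (dP A f) := by
  simp only [thomas, LinearMap.sub_apply, LinearMap.smul_apply, LinearMap.add_apply,
    LinearMap.comp_apply, map_sub, map_add, map_smul, dP_euler, dP_dX, dP_mul_coordX, dP_lap]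

theorem thomas_mul_coordP (ε : Fin m → ℝ) (c : ℝ) (A B : Fin m) (f : smoothXP m) :
    thomas ε c B (mul (coordP A) f) = mul (coordP A) (thomas ε c B f) := by
  simp only [thomas, LinearMap.sub_apply, LinearMap.smul_apply, LinearMap.add_apply,
    LinearMap.comp_apply, map_sub, map_add, map_smul, dX_mul_coordP, lap_mul_coordP,
    euler_mul_coordP, mul_comm (coordP A)]

/-- The flat Thomas-D operators commute. -/
theorem thomas_comm {ε : Fin m → ℝ} (hε : ∀ A, ε A * ε A = 1) (c : ℝ) (A B : Fin m)
    (f : smoothXP m) :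
    thomas ε c A (thomas ε c B f) = thomas ε c B (thomas ε c A f) := by
  have hAB : dX A (dX B f) = dX B (dX A f) := dir_comm _ _ f
  rcases eq_or_ne A B with rfl | hne
  · rfl
  simp only [thomas, LinearMap.sub_apply, LinearMap.smul_apply, LinearMap.add_apply,
    LinearMap.comp_apply, map_sub, map_add, map_smul, dX_euler, dX_mul_coordX, euler_mul_coordX,
    lap_mul_coordX, lap_euler, ← dX_lap, hAB, mul_comm (coordX B) (coordX A), if_neg hne,
    if_neg hne.symm, zero_smul, add_zero, smul_add, smul_sub, smul_smul]
  match_scalars <;>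
    first
    | ring1
    | linear_combination 2 * ε A * hε B
    | linear_combination -2 * ε B * hε A

theorem commute_ID_PD {ε : Fin m → ℝ} (hε : ∀ A, ε A * ε A = 1) (c : ℝ) (I : Fin m → ℝ) :
    ID ε c I * PD ε c = PD ε c * ID ε c I := by
  refine LinearMap.ext fun f => ?_
  simp only [ID, PD, Module.End.mul_apply, LinearMap.sum_apply, LinearMap.comp_apply,
    LinearMap.smul_apply, map_sum, map_smul, thomas_mul_coordP, Finset.smul_sum]
  rw [Finset.sum_comm]
  simp only [thomas_comm hε]

theorem IdP_mul_PD (ε : Fin m → ℝ) (c : ℝ) (I : Fin m → ℝ) :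
    IdP I * PD ε c = PD ε c * IdP I + ID ε c I := by
  refine LinearMap.ext fun f => ?_
  have h (A B : Fin m) : I B • dP B (mul (coordP A) (thomas ε c A f)) =
      mul (coordP A) (thomas ε c A (I B • dP B f)) +
        if A = B then I B • thomas ε c A f else 0 := by
    rw [dP_mul_coordP, dP_thomas, map_smul, map_smul]
    split_ifs <;> module
  simp only [IdP, ID, PD, Module.End.mul_apply, LinearMap.add_apply, LinearMap.sum_apply,
    LinearMap.comp_apply, LinearMap.smul_apply, map_sum, h,
    Finset.sum_add_distrib]
  congr 1
  · rw [Finset.sum_comm]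
  · simp

/-- The operator `𝔅_j` on smooth functions. -/
def waveFactor (ε : Fin m → ℝ) (c : ℝ) (I : Fin m → ℝ) (j : ℕ) : Module.End ℝ (smoothXP m) :=
  ID ε c I - (1 / (j : ℝ)) • (PD ε c * IdP I)

theorem coe_waveFactor (ε : Fin m → ℝ) (c : ℝ) (I : Fin m → ℝ) (j : ℕ) (f : smoothXP m) :
    (waveFactor ε c I j f).1 = opB ε c I j f.1 := by
  ext x p
  simp only [opB, ← coe_IdP, ← coe_PD, ← coe_ID]
  rfl

theorem IdP_mul_PD_pow {ε : Fin m → ℝ} (hε : ∀ A, ε A * ε A = 1) (c : ℝ) (I : Fin m → ℝ)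
    (j : ℕ) : IdP I * PD ε c ^ (j + 1) =
      PD ε c ^ (j + 1) * IdP I + ((j : ℝ) + 1) • (ID ε c I * PD ε c ^ j) := by
  induction j with
  | zero => simp [IdP_mul_PD]
  | succ j ih =>
    have hcomm : PD ε c ^ (j + 1) * ID ε c I = ID ε c I * PD ε c ^ (j + 1) :=
      (Commute.pow_right (commute_ID_PD hε c I) (j + 1)).symm.eq
    rw [pow_succ _ (j + 1), ← mul_assoc, ih, add_mul, mul_assoc, IdP_mul_PD, mul_add, hcomm,
      ← mul_assoc, ← pow_succ, smul_mul_assoc, mul_assoc (ID ε c I), ← pow_succ]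
    push_cast
    module

theorem waveFactor_mul_PD_pow {ε : Fin m → ℝ} (hε : ∀ A, ε A * ε A = 1) (c : ℝ) (I : Fin m → ℝ)
    {j : ℕ} (hj : 1 ≤ j) :
    waveFactor ε c I j * PD ε c ^ j = -(1 / (j : ℝ)) • (PD ε c ^ (j + 1) * IdP I) := by
  obtain ⟨j, rfl⟩ := Nat.exists_eq_add_of_le' hj
  have hcomm : PD ε c * (ID ε c I * PD ε c ^ j) = ID ε c I * PD ε c ^ (j + 1) := by
    rw [← mul_assoc, ← commute_ID_PD hε, mul_assoc, ← pow_succ']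
  have hne : ((j : ℝ) + 1) ≠ 0 := by positivity
  have hsub : waveFactor ε c I (j + 1) * PD ε c ^ (j + 1) = ID ε c I * PD ε c ^ (j + 1) -
      (1 / ((j + 1 : ℕ) : ℝ)) • (PD ε c * (IdP I * PD ε c ^ (j + 1))) := rfl
  rw [hsub, IdP_mul_PD_pow hε, mul_add, mul_smul_comm, hcomm,
    ← mul_assoc, ← pow_succ', smul_add, smul_smul]
  push_cast
  rw [one_div_mul_cancel hne]
  module

theorem exists_opBcomp_eq {ε : Fin m → ℝ} (hε : ∀ A, ε A * ε A = 1) (c : ℝ) (I : Fin m → ℝ)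
    {t : ℕ} (ht : 1 ≤ t) (k : ℕ) (f : smoothXP m) :
    ∃ C : ℝ, opBcomp ε c I t k ((opPD ε c)^[t] f.1) =
      (C • (PD ε c ^ (t + k)) ((IdP I ^ k) f)).1 := by
  induction k with
  | zero => exact ⟨1, by rw [← coe_PD_iterate, one_smul]; rfl⟩
  | succ k ih =>
    obtain ⟨C, hC⟩ := ih
    refine ⟨C * -(1 / ((t + k : ℕ) : ℝ)), ?_⟩
    have h := LinearMap.congr_fun (waveFactor_mul_PD_pow hε c I (show 1 ≤ t + k by omega))
      ((IdP I ^ k) f)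
    rw [opBcomp, hC, ← coe_waveFactor, map_smul, ← Module.End.mul_apply, h,
      pow_succ' (IdP I), mul_smul]
    rfl

theorem pdPList_append_singleton (L : List (Fin m)) (A : Fin m)
    (Φ : (Fin m → ℝ) → (Fin m → ℝ) → ℝ) : pdPList (L ++ [A]) Φ = pdPList L (pdP A Φ) := by
  induction L with
  | nil => rfl
  | cons B L ih => rw [List.cons_append, pdPList, ih, pdPList]

theorem IdP_pow_eq_zero (I : Fin m → ℝ) (N : ℕ) (f : smoothXP m)
    (h : ∀ L : List (Fin m), L.length = N → ∀ x p, pdPList L f.1 x p = 0) :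
    (IdP I ^ N) f = 0 := by
  induction N generalizing f with
  | zero =>
    ext x p
    exact h [] rfl x p
  | succ N ih =>
    rw [pow_succ, Module.End.mul_apply]
    simp only [IdP, LinearMap.sum_apply, LinearMap.smul_apply]
    rw [map_sum]
    refine Finset.sum_eq_zero fun A _ => ?_
    rw [map_smul]
    have := ih (dP A f) fun L hL x p => by
      rw [coe_dP, ← pdPList_append_singleton]
      exact h _ (by simp [hL]) x p
    rw [IdP] at this
    rw [this, smul_zero]

end smoothXP

/-- gauge invariance of the factorized CHS operator (flat ambient form): if
`eps(X,P)` is smooth and polynomial in `P` of degree at most `s - t` (all `P`-derivatives of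
order `s - t + 1` vanish), then for `ℓ ≥ s - t + 1`,
`𝔅_{t+ℓ-1} ∘ ⋯ ∘ 𝔅_t ((P·D)^t eps) = 0`. -/
theorem factorized_CHS_gauge_invariance
    (n : ℕ) (hn : 1 ≤ n) (ε : Fin (n + 2) → ℝ) (hsig : isSig ε 2)
    (I : Fin (n + 2) → ℝ) (s t ℓ : ℕ) (hs : 1 ≤ s) (ht1 : 1 ≤ t) (hts : t ≤ s)
    (hℓ : s - t + 1 ≤ ℓ)
    (eps : (Fin (n + 2) → ℝ) → (Fin (n + 2) → ℝ) → ℝ)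
    (heps : ContDiff ℝ (⊤ : ℕ∞) (Function.uncurry eps))
    (hpoly : ∀ L : List (Fin (n + 2)), L.length = s - t + 1 →
      ∀ (x p : Fin (n + 2) → ℝ), pdPList L eps x p = 0) :
    ∀ (x p : Fin (n + 2) → ℝ),
      opBcomp ε ((n : ℝ) / 2) I t ℓ ((opPD ε ((n : ℝ) / 2))^[t] eps) x p = 0 := by
  intro x p
  have hε : ∀ A, ε A * ε A = 1 := fun A => by
    rcases hsig.1 A with h | h <;> rw [h] <;> norm_num
  let F : smoothXP (n + 2) := ⟨eps, smoothXP.mem_iff.mpr heps⟩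
  obtain ⟨C, hC⟩ := smoothXP.exists_opBcomp_eq hε ((n : ℝ) / 2) I ht1 ℓ F
  have hzero : (smoothXP.IdP I ^ ℓ) F = 0 := by
    rw [← Nat.sub_add_cancel hℓ, pow_add, Module.End.mul_apply,
      smoothXP.IdP_pow_eq_zero I _ F hpoly, map_zero]
  rw [hC, hzero, map_zero, smul_zero]
  rfl

end
end

section
/- Eastwood–Singer gauge from the tractor Laplacian: let φ^a be a smooth vector field on ℝ⁴ and set Φ₀ := (0, φ^a, −(1/2) ∂_b φ^b) (a flat tractor field). Then the tractor Laplacian of Φ₀ equals ∇²Φ₀ = (0, ∂²φ^a − ∂^a ∂_b φ^b, −(1/2) ∂² ∂_b φ^b); i.e. its middle component is the Maxwell operator applied to φ and its last component is the Eastwood–Singer gauge operator −(1/2)∂²∂·φ. -/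
noncomputable section

/-- Partial derivative of a function on `ℝ⁴`. -/
def pd (μ : Fin 4) (f : (Fin 4 → ℝ) → ℝ) : (Fin 4 → ℝ) → ℝ :=
  fun x => fderiv ℝ f x (Pi.single μ 1)

/-- The wave operator `∂² = η^{μν} ∂_μ ∂_ν` for the diagonal metric `ε`. -/
def lap (ε : Fin 4 → ℝ) (f : (Fin 4 → ℝ) → ℝ) : (Fin 4 → ℝ) → ℝ :=
  fun x => ∑ μ, ε μ * pd μ (pd μ f) x

/-- The divergence `∂_b φ^b` of a vector field on `ℝ⁴`. -/
def divg (φ : (Fin 4 → ℝ) → Fin 4 → ℝ) : (Fin 4 → ℝ) → ℝ :=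
  fun x => ∑ b, pd b (fun y => φ y b) x

/-- A flat tractor field on `ℝ⁴` is a smooth map into `ℝ ⊕ ℝ⁴ ⊕ ℝ`. -/
abbrev Tractor : Type := ℝ × (Fin 4 → ℝ) × ℝ

/-- The flat tractor covariant derivative
`∇_μ(Φ⁻, Φ^a, Φ⁺) = (∂_μΦ⁻ - Φ_μ, ∂_μΦ^a + δ_μ^a Φ⁺, ∂_μΦ⁺)` with `Φ_μ = η_{μa}Φ^a`. -/
def tracDeriv (ε : Fin 4 → ℝ) (μ : Fin 4) (Φ : (Fin 4 → ℝ) → Tractor) :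
    (Fin 4 → ℝ) → Tractor :=
  fun x =>
    (pd μ (fun y => (Φ y).1) x - ε μ * (Φ x).2.1 μ,
     fun a => pd μ (fun y => (Φ y).2.1 a) x + (if a = μ then (Φ x).2.2 else 0),
     pd μ (fun y => (Φ y).2.2) x)

/-- The tractor Laplacian `∇² = η^{μν} ∇_μ ∇_ν`. -/
def tracLap (ε : Fin 4 → ℝ) (Φ : (Fin 4 → ℝ) → Tractor) : (Fin 4 → ℝ) → Tractor :=
  fun x => ∑ μ, ε μ • tracDeriv ε μ (tracDeriv ε μ Φ) x

theorem pd_zero (μ : Fin 4) : pd μ (fun _ => 0) = fun _ => 0 := by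
  funext x
  simp [pd]

theorem pd_add {f g : (Fin 4 → ℝ) → ℝ} (hf : Differentiable ℝ f) (hg : Differentiable ℝ g)
    (μ : Fin 4) : pd μ (fun y => f y + g y) = fun y => pd μ f y + pd μ g y := by
  funext x
  simp [pd, fderiv_fun_add (hf x) (hg x)]

theorem pd_const_mul {f : (Fin 4 → ℝ) → ℝ} (hf : Differentiable ℝ f) (c : ℝ) (μ : Fin 4) :
    pd μ (fun y => c * f y) = fun y => c * pd μ f y := by
  funext x
  simp [pd, fderiv_const_mul (hf x) c]

theorem contDiff_pd {f : (Fin 4 → ℝ) → ℝ} (hf : ContDiff ℝ (⊤ : ℕ∞) f) (μ : Fin 4) :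
    ContDiff ℝ (⊤ : ℕ∞) (pd μ f) :=
  (hf.fderiv_right (m := (⊤ : ℕ∞)) (by simp)).clm_apply contDiff_const

theorem contDiff_divg {φ : (Fin 4 → ℝ) → Fin 4 → ℝ} (hφ : ContDiff ℝ (⊤ : ℕ∞) φ) :
    ContDiff ℝ (⊤ : ℕ∞) (divg φ) :=
  ContDiff.sum fun b _ => contDiff_pd (contDiff_pi.1 hφ b) b

/-- Eastwood–Singer gauge from the tractor Laplacian: for a smooth vector
field `φ` on `ℝ⁴` and `Φ₀ = (0, φ^a, -(1/2)∂_bφ^b)`, the tractor Laplacian is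
`∇²Φ₀ = (0, ∂²φ^a - ∂^a∂_bφ^b, -(1/2)∂²∂_bφ^b)`: its middle component is the Maxwell
operator applied to `φ` and its last component is the Eastwood–Singer gauge operator. -/
theorem tractor_laplacian_eastwood_singer
    (ε : Fin 4 → ℝ) (hε : ∀ a, ε a = 1 ∨ ε a = -1)
    (hsig : Nat.card {a : Fin 4 // ε a = -1} = 1)
    (φ : (Fin 4 → ℝ) → Fin 4 → ℝ) (hφ : ContDiff ℝ (⊤ : ℕ∞) φ) :
    ∀ x : Fin 4 → ℝ,
      tracLap ε (fun y => ((0 : ℝ), φ y, -(1 / 2) * divg φ y)) x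
        = ((0 : ℝ),
           fun a => lap ε (fun y => φ y a) x - ε a * pd a (divg φ) x,
           -(1 / 2) * lap ε (divg φ) x) := by
  intro x
  have hε2 : ∀ a, ε a * ε a = 1 := fun a => by rcases hε a with h | h <;> simp [h]
  have hc : ∀ a, ContDiff ℝ (⊤ : ℕ∞) (fun y => φ y a) := contDiff_pi.1 hφ
  have hd : ∀ a, Differentiable ℝ (fun y => φ y a) := fun a => (hc a).differentiable (by simp)
  have hpd : ∀ μ a, Differentiable ℝ (pd μ (fun y => φ y a)) :=
    fun μ a => (contDiff_pd (hc a) μ).differentiable (by simp)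
  have hdiv : Differentiable ℝ (divg φ) := (contDiff_divg hφ).differentiable (by simp)
  have hpdiv : ∀ μ, Differentiable ℝ (pd μ (divg φ)) :=
    fun μ => (contDiff_pd (contDiff_divg hφ) μ).differentiable (by simp)
  have hstep : ∀ μ, tracDeriv ε μ (tracDeriv ε μ
      (fun y => ((0 : ℝ), φ y, -(1 / 2) * divg φ y))) x =
      (-ε μ * pd μ (fun y => φ y μ) x - ε μ * (pd μ (fun y => φ y μ) x + -(1 / 2) * divg φ x),
       fun a => pd μ (pd μ (fun y => φ y a)) x + (if a = μ then -pd a (divg φ) x else 0),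
       -(1 / 2) * pd μ (pd μ (divg φ)) x) := by
    intro μ
    simp only [tracDeriv, pd_zero, pd_const_mul hdiv, pd_const_mul (hpdiv μ), if_true]
    refine Prod.ext ?_ (Prod.ext (funext fun a => ?_) rfl)
    · simp only [zero_sub, ← neg_mul, pd_const_mul (hd μ)]
    · by_cases h : a = μ
      · subst h
        simp only [if_true, pd_add (hpd a a) (hdiv.const_mul _), pd_const_mul hdiv]
        ring
      · simp [h]
  simp only [tracLap, hstep]
  refine Prod.ext ?_ (Prod.ext (funext fun a => ?_) ?_)
  · simp only [Prod.fst_sum, Prod.smul_fst, smul_eq_mul]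
    have : ∀ μ, ε μ * (-ε μ * pd μ (fun y => φ y μ) x -
        ε μ * (pd μ (fun y => φ y μ) x + -(1 / 2) * divg φ x)) =
        -2 * pd μ (fun y => φ y μ) x + 1 / 2 * divg φ x := fun μ => by
      linear_combination
        (-2 * pd μ (fun y => φ y μ) x + 1 / 2 * divg φ x) * hε2 μ
    simp only [this, Finset.sum_add_distrib, ← Finset.mul_sum]
    simp [divg]
    ring
  · simp only [Prod.snd_sum, Prod.fst_sum, Prod.smul_fst, Prod.smul_snd, Finset.sum_apply,
      Pi.smul_apply, smul_eq_mul, mul_add, Finset.sum_add_distrib, lap]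
    simp [sub_eq_add_neg]
  · simp only [Prod.snd_sum, Prod.smul_snd, smul_eq_mul, lap, Finset.mul_sum]
    exact Finset.sum_congr rfl fun μ _ => by ring

end
end
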